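/- Let 0 < σ < 1 and let u, v be divergence-free vector fields on ℝ³ with u ∈ Ḃ^σ_{∞,∞}, v ∈ L² ∩ Ḣ¹. Then |∫_{ℝ³} u · (v·∇)v dx| ≤ C ‖u‖_{Ḃ^σ_{∞,∞}} ‖v‖₂^(1+σ) ‖∇⊗v‖₂^(1−σ), where C depends only on σ. -/

import Mathlib

open MeasureTheory Real
open scoped ENNReal

noncomputable section

/-- Partial derivative `∂_j v_i` of a vector field on `ℝ³`. -/
def pd (v : EuclideanSpace ℝ (Fin 3) → EuclideanSpace ℝ (Fin 3)) (i j : Fin 3)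
    (x : EuclideanSpace ℝ (Fin 3)) : ℝ :=
  fderiv ℝ (fun y => v y i) x (EuclideanSpace.single j 1)

abbrev E3 := EuclideanSpace ℝ (Fin 3)

lemma pow_split {σ ε t : ℝ} (h0 : 0 < σ) (h1 : σ < 1) (hε : 0 < ε) (ht : 0 ≤ t) :
    t ^ σ ≤ ε ^ σ + ε ^ (σ - 1) * t := by
  rcases le_total t ε with h | h
  · have := Real.rpow_le_rpow ht h h0.le
    have : 0 ≤ ε ^ (σ - 1) * t := by positivity
    linarith
  · have htp : 0 < t := by linarith
    have h2 : t ^ (σ - 1) ≤ ε ^ (σ - 1) := Real.rpow_le_rpow_of_nonpos hε h (by linarith)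
    have h3 : t ^ σ = t ^ (σ - 1) * t := by
      rw [Real.rpow_sub_one htp.ne']; field_simp
    have : 0 ≤ ε ^ σ := by positivity
    rw [h3]
    nlinarith

lemma infconv {σ ε A : ℝ} (h0 : 0 < σ) (h1 : σ < 1) (hε : 0 < ε) (hA : 0 ≤ A) (f : E3 → ℝ)
    (hf : ∀ x y, |f x - f y| ≤ A * ‖x - y‖ ^ σ) :
    ∃ g : E3 → ℝ, LipschitzWith (Real.toNNReal (A * ε ^ (σ - 1))) g ∧
      ∀ x, |f x - g x| ≤ A * ε ^ σ := by
  set L := A * ε ^ (σ - 1) with hL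
  have hL0 : 0 ≤ L := by positivity
  have key : ∀ x y, f x - A * ε ^ σ ≤ f y + L * ‖x - y‖ := by
    intro x y
    have := (abs_le.1 (hf x y)).2
    have h2 := mul_le_mul_of_nonneg_left (pow_split h0 h1 hε (norm_nonneg (x - y))) hA
    rw [hL]; nlinarith
  have bdd : ∀ x, BddBelow (Set.range fun y => f y + L * ‖x - y‖) := by
    intro x
    refine ⟨f x - A * ε ^ σ, ?_⟩
    rintro _ ⟨y, rfl⟩
    exact key x y
  refine ⟨fun x => ⨅ y, (f y + L * ‖x - y‖), ?_, ?_⟩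
  · refine LipschitzWith.of_le_add_mul _ ?_
    intro x y
    rw [Real.coe_toNNReal _ hL0, ← sub_le_iff_le_add]
    refine le_ciInf fun z => ?_
    rw [sub_le_iff_le_add]
    refine (ciInf_le (bdd x) z).trans ?_
    have : ‖x - z‖ ≤ ‖y - z‖ + dist x y := by
      rw [dist_eq_norm]
      calc ‖x - z‖ = ‖(y - z) + (x - y)‖ := by congr 1; abel
        _ ≤ _ := norm_add_le _ _
    nlinarith
  · intro x
    have a := ciInf_le (bdd x) x
    have b : f x - A * ε ^ σ ≤ ⨅ y, (f y + L * ‖x - y‖) := le_ciInf fun y => key x y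
    simp only [sub_self, norm_zero, mul_zero, add_zero] at a
    rw [abs_le]
    constructor
    · have : 0 ≤ A * ε ^ σ := by positivity
      linarith
    · linarith

lemma cutoff : ∃ (χ : ℕ → E3 → ℝ) (M : ℝ), 0 ≤ M ∧ (∀ n, ContDiff ℝ 1 (χ n)) ∧
    (∀ n, HasCompactSupport (χ n)) ∧ (∀ n x, 0 ≤ χ n x) ∧ (∀ n x, χ n x ≤ 1) ∧
    (∀ n x, ‖fderiv ℝ (χ n) x‖ * (1 + ‖x‖) ≤ M) ∧
    (∀ x, ∀ᶠ n in Filter.atTop, χ n x = 1 ∧ fderiv ℝ (χ n) x = 0) := by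
  let b : ContDiffBump (0 : E3) := ⟨1, 2, by norm_num, by norm_num⟩
  have hb : ContDiff ℝ 1 (b : E3 → ℝ) := b.contDiff
  have hc : HasCompactSupport (b : E3 → ℝ) := b.hasCompactSupport
  have hd : Continuous (fun x : E3 => (1 + ‖x‖) • fderiv ℝ (b : E3 → ℝ) x) := by
    have := hb.continuous_fderiv (by norm_num)
    fun_prop
  have hdc : HasCompactSupport (fun x : E3 => (1 + ‖x‖) • fderiv ℝ (b : E3 → ℝ) x) :=
    HasCompactSupport.smul_left (f := fun x : E3 => (1 + ‖x‖)) (hc.fderiv ℝ)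
  obtain ⟨M, hM⟩ := hdc.exists_bound_of_continuous hd
  have hM' : ∀ x, ‖fderiv ℝ (b : E3 → ℝ) x‖ * (1 + ‖x‖) ≤ M := by
    intro x
    have := hM x
    rw [norm_smul, Real.norm_of_nonneg (by positivity)] at this
    linarith
  have hfd : ∀ (n : ℕ) x, fderiv ℝ (fun x : E3 => b (((n : ℝ) + 1)⁻¹ • x)) x
      = ((n : ℝ) + 1)⁻¹ • fderiv ℝ (b : E3 → ℝ) (((n : ℝ) + 1)⁻¹ • x) := by
    intro n x
    exact fderiv_comp_smul _
  refine ⟨fun n x => b (((n : ℝ) + 1)⁻¹ • x), M, ?_, ?_, ?_, fun n x => b.nonneg, fun n x => b.le_one, ?_, ?_⟩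
  · refine le_trans ?_ (hM' 0); positivity
  · intro n
    exact hb.comp (contDiff_const_smul _)
  · intro n
    exact hc.comp_smul (by positivity)
  · intro n x
    rw [hfd, norm_smul, Real.norm_of_nonneg (by positivity)]
    refine le_trans ?_ (hM' (((n : ℝ) + 1)⁻¹ • x))
    rw [norm_smul, Real.norm_of_nonneg (by positivity)]
    have h1 : ((n : ℝ) + 1)⁻¹ ≤ 1 := inv_le_one_of_one_le₀ (by linarith [(Nat.cast_nonneg n : (0:ℝ) ≤ n)])
    nlinarith [norm_nonneg (fderiv ℝ (b : E3 → ℝ) (((n : ℝ) + 1)⁻¹ • x)), norm_nonneg x]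
  · intro x
    obtain ⟨N, hN⟩ := exists_nat_gt ‖x‖
    filter_upwards [Filter.eventually_ge_atTop N] with n hn
    have hn' : (N : ℝ) ≤ n := by exact_mod_cast hn
    have hlt : ‖((n : ℝ) + 1)⁻¹ • x‖ < 1 := by
      rw [norm_smul, Real.norm_of_nonneg (by positivity), inv_mul_lt_iff₀ (by positivity)]
      linarith
    have hin : ((n : ℝ) + 1)⁻¹ • x ∈ Metric.ball (0 : E3) b.rIn := by
      simpa using hlt
    refine ⟨b.one_of_mem_closedBall (Metric.ball_subset_closedBall hin), ?_⟩
    rw [hfd, (b.eventuallyEq_one_of_mem_ball hin).fderiv_eq]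
    simp [Pi.one_def]

lemma one_term (w : E3 → ℝ) (hw : ContDiff ℝ 1 w) (hc : HasCompactSupport w)
    {L : NNReal} {g : E3 → ℝ} (hg : LipschitzWith L g) (j : Fin 3) (P : E3 → ℝ) (hP : Integrable P)
    (hwP : ∀ x, |w x| ≤ P x) :
    |∫ x, g x * fderiv ℝ w x (EuclideanSpace.single j 1)| ≤ L * ∫ x, P x := by
  obtain ⟨D, hD⟩ := ContDiff.lipschitzWith_of_hasCompactSupport hc hw (by simp)
  have h := LipschitzWith.integral_lineDeriv_mul_eq (μ := volume) hg hD hc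
    (-(EuclideanSpace.single j (1 : ℝ)))
  rw [neg_neg] at h
  have h2 : ∫ x, g x * fderiv ℝ w x (EuclideanSpace.single j 1)
      = ∫ x, lineDeriv ℝ w x (EuclideanSpace.single j 1) * g x := by
    congr 1; ext x
    rw [(hw.differentiable (by simp)).differentiableAt.lineDeriv_eq_fderiv, mul_comm]
  rw [h2, ← h, ← integral_const_mul, ← Real.norm_eq_abs]
  refine norm_integral_le_of_norm_le (hP.const_mul _) (Filter.Eventually.of_forall fun x => ?_)
  rw [norm_mul]
  have h3 := norm_lineDeriv_le_of_lipschitz ℝ hg (x₀ := x) (v := -(EuclideanSpace.single j (1 : ℝ)))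
  rw [norm_neg, EuclideanSpace.norm_single, norm_one, mul_one] at h3
  exact mul_le_mul h3 (hwP x) (norm_nonneg _) L.coe_nonneg

lemma coord_le (x : E3) (i : Fin 3) : |x i| ≤ ‖x‖ := by
  simpa using PiLp.norm_apply_le x i

lemma lip_part (v : E3 → E3) (hv : ContDiff ℝ 1 v) (hv2 : Integrable (fun x => ‖v x‖ ^ 2))
    (hdiv : ∀ x, ∑ i, pd v i i x = 0) {L : NNReal} (g : Fin 3 → E3 → ℝ)
    (hg : ∀ i, LipschitzWith L (g i))
    (hF : Integrable (fun x => ∑ i, ∑ j, g i x * v x j * pd v i j x)) :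
    |∫ x, ∑ i, ∑ j, g i x * v x j * pd v i j x| ≤ 9 * L * ∫ x, ‖v x‖ ^ 2 := by
  obtain ⟨χ, M, hM0, hχd, hχc, hχ0, hχ1, hχM, hχl⟩ := cutoff
  have hvi : ∀ i, ContDiff ℝ 1 (fun x => v x i) := fun i => by
    exact (EuclideanSpace.proj (𝕜 := ℝ) i).contDiff.comp hv
  have hw : ∀ n i j, ContDiff ℝ 1 (fun x => χ n x * (v x j * v x i)) := fun n i j =>
    (hχd n).mul ((hvi j).mul (hvi i))
  have hwc : ∀ n i j, HasCompactSupport (fun x => χ n x * (v x j * v x i)) := fun n i j =>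
    (hχc n).mul_right
  have hgc : ∀ i, Continuous (g i) := fun i => (hg i).continuous
  have hfw : ∀ n i j x, fderiv ℝ (fun x => χ n x * (v x j * v x i)) x (EuclideanSpace.single j 1)
      = χ n x * (v x j * pd v i j x + v x i * pd v j j x)
        + v x j * v x i * fderiv ℝ (χ n) x (EuclideanSpace.single j 1) := by
    intro n i j x
    have d1 : DifferentiableAt ℝ (χ n) x := ((hχd n).differentiable (by simp)).differentiableAt
    have d2 : ∀ i, DifferentiableAt ℝ (fun x => v x i) x := fun i =>
      ((hvi i).differentiable (by simp)).differentiableAt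
    rw [fderiv_fun_mul d1 ((d2 j).fun_mul (d2 i)), fderiv_fun_mul (d2 j) (d2 i)]
    simp [pd]
    ring
  have hint : ∀ n i j, Integrable (fun x => g i x *
      fderiv ℝ (fun x => χ n x * (v x j * v x i)) x (EuclideanSpace.single j 1)) := by
    intro n i j
    refine Continuous.integrable_of_hasCompactSupport ?_ ?_
    · have := (hw n i j).continuous_fderiv (by simp)
      have := hgc i
      fun_prop
    · exact HasCompactSupport.mul_left ((hwc n i j).fderiv_apply ℝ _)
  have hb : ∀ n, |∫ x, ∑ i, ∑ j, g i x *
      fderiv ℝ (fun x => χ n x * (v x j * v x i)) x (EuclideanSpace.single j 1)|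
      ≤ 9 * L * ∫ x, ‖v x‖ ^ 2 := by
    intro n
    rw [integral_finsetSum _ (fun i _ => integrable_finsetSum _ fun j _ => hint n i j)]
    have : ∀ i, ∫ x, ∑ j, g i x *
      fderiv ℝ (fun x => χ n x * (v x j * v x i)) x (EuclideanSpace.single j 1)
       = ∑ j, ∫ x, g i x *
      fderiv ℝ (fun x => χ n x * (v x j * v x i)) x (EuclideanSpace.single j 1) := fun i =>
      integral_finsetSum _ (fun j _ => hint n i j)
    simp_rw [this]
    have hij : ∀ i j, |∫ x, g i x *
      fderiv ℝ (fun x => χ n x * (v x j * v x i)) x (EuclideanSpace.single j 1)|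
        ≤ L * ∫ x, ‖v x‖ ^ 2 := by
      intro i j
      refine one_term _ (hw n i j) (hwc n i j) (hg i) j _ hv2 fun x => ?_
      rw [abs_mul, abs_mul, abs_of_nonneg (hχ0 n x), sq]
      have := mul_le_mul (coord_le (v x) j) (coord_le (v x) i) (abs_nonneg _) (norm_nonneg _)
      have h3 := mul_le_mul (hχ1 n x) this (by positivity) zero_le_one
      linarith
    calc _ ≤ ∑ i : Fin 3, ∑ j : Fin 3, L * ∫ x, ‖v x‖ ^ 2 :=
          (Finset.abs_sum_le_sum_abs _ _).trans (Finset.sum_le_sum fun i _ =>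
            (Finset.abs_sum_le_sum_abs _ _).trans (Finset.sum_le_sum fun j _ => hij i j))
      _ = _ := by simp; ring
  have heq : ∀ n x, ∑ i, ∑ j, g i x *
      fderiv ℝ (fun x => χ n x * (v x j * v x i)) x (EuclideanSpace.single j 1)
      = χ n x * (∑ i, ∑ j, g i x * v x j * pd v i j x)
        + ∑ i, ∑ j, g i x * (v x j * v x i * fderiv ℝ (χ n) x (EuclideanSpace.single j 1)) := by
    intro n x
    have h0 : ∑ i, g i x * χ n x * v x i * (∑ j, pd v j j x) = 0 := by simp [hdiv x]
    rw [← add_zero (χ n x * _), ← h0]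
    simp_rw [hfw, Finset.mul_sum, ← Finset.sum_add_distrib]
    refine Finset.sum_congr rfl fun i _ => Finset.sum_congr rfl fun j _ => ?_
    ring
  obtain ⟨K, hK0, hK⟩ : ∃ K : ℝ, 0 ≤ K ∧ ∀ i x, |g i x| ≤ K * (1 + ‖x‖) := by
    refine ⟨(∑ i, |g i 0|) + L, by positivity, fun i x => ?_⟩
    have h1 := (hg i).dist_le_mul x 0
    rw [Real.dist_eq, dist_zero_right] at h1
    have h2 : |g i x| ≤ |g i x - g i 0| + |g i 0| := by
      simpa using abs_add_le (g i x - g i 0) (g i 0)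
    have h3 : |g i 0| ≤ ∑ i, |g i 0| :=
      Finset.single_le_sum (f := fun i => |g i 0|) (fun _ _ => abs_nonneg _) (Finset.mem_univ i)
    have h4 : 0 ≤ (∑ i, |g i 0|) * ‖x‖ := by positivity
    nlinarith [L.coe_nonneg]
  have hlim : Filter.Tendsto (fun n => ∫ x, ∑ i, ∑ j, g i x *
      fderiv ℝ (fun x => χ n x * (v x j * v x i)) x (EuclideanSpace.single j 1)) Filter.atTop
      (nhds (∫ x, ∑ i, ∑ j, g i x * v x j * pd v i j x)) := by
    refine tendsto_integral_of_dominated_convergence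
      (fun x => |∑ i, ∑ j, g i x * v x j * pd v i j x| + 9 * (K * M) * ‖v x‖ ^ 2) ?_ ?_ ?_ ?_
    · intro n
      exact (integrable_finsetSum _ fun i _ => integrable_finsetSum _ fun j _ =>
        hint n i j).aestronglyMeasurable
    · exact hF.abs.add (hv2.const_mul _)
    · intro n
      refine Filter.Eventually.of_forall fun x => ?_
      rw [heq, Real.norm_eq_abs]
      refine (abs_add_le _ _).trans (add_le_add ?_ ?_)
      · rw [abs_mul, abs_of_nonneg (hχ0 n x)]
        exact mul_le_of_le_one_left (abs_nonneg _) (hχ1 n x)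
      · have hij : ∀ i j, |g i x * (v x j * v x i *
            fderiv ℝ (χ n) x (EuclideanSpace.single j 1))| ≤ K * M * ‖v x‖ ^ 2 := by
          intro i j
          have e1 : |fderiv ℝ (χ n) x (EuclideanSpace.single j 1)| ≤ ‖fderiv ℝ (χ n) x‖ := by
            have := (fderiv ℝ (χ n) x).le_opNorm (EuclideanSpace.single j 1)
            rwa [EuclideanSpace.norm_single, norm_one, mul_one, Real.norm_eq_abs] at this
          have e2 := mul_le_mul (coord_le (v x) j) (coord_le (v x) i) (abs_nonneg _)
            (norm_nonneg _)
          have e3 : |g i x| * |fderiv ℝ (χ n) x (EuclideanSpace.single j 1)| ≤ K * M := by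
            calc _ ≤ (K * (1 + ‖x‖)) * ‖fderiv ℝ (χ n) x‖ :=
                  mul_le_mul (hK i x) e1 (abs_nonneg _) (by positivity)
              _ = K * (‖fderiv ℝ (χ n) x‖ * (1 + ‖x‖)) := by ring
              _ ≤ _ := mul_le_mul_of_nonneg_left (hχM n x) hK0
          rw [abs_mul, abs_mul, abs_mul]
          calc _ = (|g i x| * |fderiv ℝ (χ n) x (EuclideanSpace.single j 1)|)
                * (|v x j| * |v x i|) := by ring
            _ ≤ (K * M) * (‖v x‖ * ‖v x‖) := mul_le_mul e3 e2 (by positivity) (by positivity)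
            _ = _ := by ring
        calc _ ≤ ∑ i : Fin 3, ∑ j : Fin 3, K * M * ‖v x‖ ^ 2 :=
              (Finset.abs_sum_le_sum_abs _ _).trans (Finset.sum_le_sum fun i _ =>
                (Finset.abs_sum_le_sum_abs _ _).trans (Finset.sum_le_sum fun j _ => hij i j))
          _ = _ := by simp; ring
    · refine Filter.Eventually.of_forall fun x => ?_
      refine tendsto_const_nhds.congr' ?_
      filter_upwards [hχl x] with n hn
      rw [heq, hn.1, hn.2]
      simp
  exact le_of_tendsto hlim.abs (Filter.Eventually.of_forall hb)

set_option maxHeartbeats 1000000 in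
lemma eps_bound {σ : ℝ} (h0 : 0 < σ) (h1 : σ < 1) {ε : ℝ} (hε : 0 < ε) (u v : E3 → E3) (Cu : ℝ)
    (hCu : 0 ≤ Cu) (hu : ∀ x y, ‖u x - u y‖ ≤ Cu * ‖x - y‖ ^ σ)
    (hv : ContDiff ℝ 1 v) (hv2 : Integrable (fun x => ‖v x‖ ^ 2))
    (hp : Integrable (fun x => ∑ i, ∑ j, pd v i j x ^ 2))
    (hdiv : ∀ x, ∑ i, pd v i i x = 0)
    (hF : Integrable (fun x => ∑ i, ∑ j, u x i * v x j * pd v i j x)) :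
    |∫ x, ∑ i, ∑ j, u x i * v x j * pd v i j x| ≤
      9 * Cu * (2 * (ε ^ (σ - 1) * ∫ x, ‖v x‖ ^ 2)
        + ε ^ (σ + 1) * ∫ x, ∑ i, ∑ j, pd v i j x ^ 2) := by
  have hui : ∀ i x y, |u x i - u y i| ≤ Cu * ‖x - y‖ ^ σ := fun i x y =>
    (coord_le (u x - u y) i).trans (hu x y)
  choose g hgL hgu using fun i => infconv h0 h1 hε hCu (fun x => u x i) (hui i)
  have hL0 : 0 ≤ Cu * ε ^ (σ - 1) := by positivity
  have hvc : ∀ i, ContDiff ℝ 1 (fun x => v x i) := fun i => by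
    exact (EuclideanSpace.proj (𝕜 := ℝ) i).contDiff.comp hv
  have huc : ∀ i, Continuous (fun x => u x i) := by
    intro i
    rw [continuous_iff_continuousAt]
    intro x
    rw [ContinuousAt, tendsto_iff_norm_sub_tendsto_zero]
    have : Filter.Tendsto (fun y => Cu * ‖y - x‖ ^ σ) (nhds x) (nhds 0) := by
      have hc : Continuous (fun y : E3 => Cu * ‖y - x‖ ^ σ) :=
        continuous_const.mul ((continuous_id.sub continuous_const).norm.rpow_const
          fun _ => Or.inr h0.le)
      have := hc.tendsto x
      simpa [Real.zero_rpow h0.ne'] using this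
    exact squeeze_zero (fun _ => norm_nonneg _) (fun y => hui i y x) this
  have hpc : ∀ i j, Continuous (fun x => pd v i j x) := by
    intro i j
    have := (hvc i).continuous_fderiv (by simp)
    unfold pd
    fun_prop
  set H : E3 → ℝ := fun x => ∑ i, ∑ j, (u x i - g i x) * v x j * pd v i j x with hH
  set Q : E3 → ℝ := fun x => 9 * Cu * (ε ^ (σ - 1) * ‖v x‖ ^ 2
      + ε ^ (σ + 1) * ∑ i, ∑ j, pd v i j x ^ 2) with hQ
  have hQi : Integrable Q := ((hv2.const_mul _).add (hp.const_mul _)).const_mul _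
  have hHQ : ∀ x, ‖H x‖ ≤ Q x := by
    intro x
    have hij : ∀ i j, |(u x i - g i x) * v x j * pd v i j x| ≤
        Cu * (ε ^ (σ - 1) * ‖v x‖ ^ 2 + ε ^ (σ + 1) * ∑ i, ∑ j, pd v i j x ^ 2) := by
      intro i j
      have e1 : pd v i j x ^ 2 ≤ ∑ i, ∑ j, pd v i j x ^ 2 :=
        (Finset.single_le_sum (f := fun j => pd v i j x ^ 2) (fun _ _ => sq_nonneg _)
          (Finset.mem_univ j)).trans
        (Finset.single_le_sum (f := fun i => ∑ j, pd v i j x ^ 2)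
          (fun _ _ => Finset.sum_nonneg fun _ _ => sq_nonneg _) (Finset.mem_univ i))
      have e2 : |v x j| ^ 2 ≤ ‖v x‖ ^ 2 := by
        have := coord_le (v x) j
        gcongr
      have e3 : ε ^ σ = ε ^ (σ - 1) * ε := by
        rw [Real.rpow_sub_one hε.ne']; field_simp
      have e4 : ε ^ (σ + 1) = ε ^ (σ - 1) * ε * ε := by
        rw [Real.rpow_add_one hε.ne', e3]
      have hr : 0 ≤ ε ^ (σ - 1) := by positivity
      have e5 : |v x j| * |pd v i j x| * ε ≤ |v x j| ^ 2 + ε ^ 2 * pd v i j x ^ 2 := by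
        rw [← sq_abs (pd v i j x)]
        nlinarith [sq_nonneg (|v x j| - ε * |pd v i j x|), sq_nonneg (|v x j|),
          sq_nonneg (ε * |pd v i j x|)]
      rw [abs_mul, abs_mul]
      calc |u x i - g i x| * |v x j| * |pd v i j x| ≤ Cu * ε ^ σ * |v x j| * |pd v i j x| := by
            have := hgu i x
            gcongr
        _ = Cu * (ε ^ (σ - 1) * (|v x j| * |pd v i j x| * ε)) := by rw [e3]; ring
        _ ≤ Cu * (ε ^ (σ - 1) * (‖v x‖ ^ 2 + ε ^ 2 * ∑ i, ∑ j, pd v i j x ^ 2)) := by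
            have : ε ^ 2 * pd v i j x ^ 2 ≤ ε ^ 2 * ∑ i, ∑ j, pd v i j x ^ 2 := by gcongr
            have := e5.trans (add_le_add e2 this)
            gcongr
        _ = _ := by rw [e4]; ring
    calc _ ≤ ∑ i : Fin 3, ∑ j : Fin 3, Cu * (ε ^ (σ - 1) * ‖v x‖ ^ 2
            + ε ^ (σ + 1) * ∑ i, ∑ j, pd v i j x ^ 2) :=
          (Finset.abs_sum_le_sum_abs _ _).trans (Finset.sum_le_sum fun i _ =>
            (Finset.abs_sum_le_sum_abs _ _).trans (Finset.sum_le_sum fun j _ => hij i j))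
      _ = _ := by
        rw [hQ]
        simp only [Finset.sum_const, Finset.card_univ, Fintype.card_fin, nsmul_eq_mul]
        push_cast
        ring
  have hHc : Continuous H := by
    refine continuous_finsetSum _ fun i _ => continuous_finsetSum _ fun j _ => ?_
    exact (((huc i).sub (hgL i).continuous).mul (hvc j).continuous).mul (hpc i j)
  have hHi : Integrable H := hQi.mono' hHc.aestronglyMeasurable (Filter.Eventually.of_forall hHQ)
  have hsub : ∀ x, ∑ i, ∑ j, g i x * v x j * pd v i j x
      = (∑ i, ∑ j, u x i * v x j * pd v i j x) - H x := by
    intro x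
    simp only [hH, ← Finset.sum_sub_distrib]
    refine Finset.sum_congr rfl fun i _ => Finset.sum_congr rfl fun j _ => ?_
    ring
  have hGi : Integrable (fun x => ∑ i, ∑ j, g i x * v x j * pd v i j x) := by
    simp_rw [hsub]
    exact hF.sub hHi
  have hG := lip_part v hv hv2 hdiv g hgL hGi
  rw [Real.coe_toNNReal _ hL0] at hG
  have hHb : |∫ x, H x| ≤ ∫ x, Q x :=
    norm_integral_le_of_norm_le hQi (Filter.Eventually.of_forall hHQ)
  have hQe : ∫ x, Q x = 9 * Cu * (ε ^ (σ - 1) * (∫ x, ‖v x‖ ^ 2)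
      + ε ^ (σ + 1) * ∫ x, ∑ i, ∑ j, pd v i j x ^ 2) := by
    rw [hQ, integral_const_mul, integral_add (hv2.const_mul _) (hp.const_mul _),
      integral_const_mul, integral_const_mul]
  have hsum : ∫ x, ∑ i, ∑ j, u x i * v x j * pd v i j x
      = (∫ x, ∑ i, ∑ j, g i x * v x j * pd v i j x) + ∫ x, H x := by
    rw [← integral_add hGi hHi]
    congr 1; ext x
    rw [hsub]; ring
  rw [hsum]
  refine (abs_add_le _ _).trans ?_
  rw [hQe] at hHb
  linarith

theorem besov_trilinear_estimate (σ : ℝ) (hσ0 : 0 < σ) (hσ1 : σ < 1) :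
    ∃ C : ℝ, 0 < C ∧
      ∀ (u v : EuclideanSpace ℝ (Fin 3) → EuclideanSpace ℝ (Fin 3)) (Cu : ℝ),
        0 ≤ Cu →
        -- `u ∈ Ḃ^σ_{∞,∞}` with norm at most `Cu` (Hölder–Zygmund seminorm)
        (∀ x y, ‖u x - u y‖ ≤ Cu * ‖x - y‖ ^ σ) →
        -- `u` is divergence-free (in the sense of distributions)
        (∀ φ : EuclideanSpace ℝ (Fin 3) → ℝ, ContDiff ℝ (⊤ : ℕ∞) φ → HasCompactSupport φ →
          ∫ x, ∑ i, u x i * fderiv ℝ φ x (EuclideanSpace.single i 1) = 0) →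
        -- `v ∈ L² ∩ Ḣ¹`, divergence-free
        ContDiff ℝ 1 v →
        Integrable (fun x => ‖v x‖ ^ 2) →
        Integrable (fun x => ∑ i, ∑ j, pd v i j x ^ 2) →
        (∀ x, ∑ i, pd v i i x = 0) →
        Integrable (fun x => ∑ i, ∑ j, u x i * v x j * pd v i j x) →
        |∫ x, ∑ i, ∑ j, u x i * v x j * pd v i j x| ≤
          C * Cu * Real.sqrt (∫ x, ‖v x‖ ^ 2) ^ (1 + σ) *
            Real.sqrt (∫ x, ∑ i, ∑ j, pd v i j x ^ 2) ^ (1 - σ) := by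
  refine ⟨27, by norm_num, ?_⟩
  intro u v Cu hCu hu _ hv hv2 hp hdiv hF
  have hA0 : 0 ≤ ∫ x, ‖v x‖ ^ 2 := integral_nonneg fun x => by positivity
  have hB0 : 0 ≤ ∫ x, ∑ i, ∑ j, pd v i j x ^ 2 := integral_nonneg fun x => by positivity
  have hR : 0 ≤ 27 * Cu * Real.sqrt (∫ x, ‖v x‖ ^ 2) ^ (1 + σ) *
            Real.sqrt (∫ x, ∑ i, ∑ j, pd v i j x ^ 2) ^ (1 - σ) := by positivity
  rcases hA0.eq_or_lt' with hA | hA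
  · rw [integral_eq_zero_of_ae, abs_zero]
    · exact hR
    · have := (integral_eq_zero_iff_of_nonneg (fun x => by positivity) hv2).1 hA
      filter_upwards [this] with x hx
      have : v x = 0 := by simpa using hx
      simp [this]
  rcases hB0.eq_or_lt' with hB | hB
  · rw [integral_eq_zero_of_ae, abs_zero]
    · exact hR
    · have := (integral_eq_zero_iff_of_nonneg (fun x => by positivity) hp).1 hB
      filter_upwards [this] with x hx
      have h1 : ∀ i j, pd v i j x = 0 := by
        intro i j
        have h2 := (Finset.sum_eq_zero_iff_of_nonneg
          (fun i _ => Finset.sum_nonneg fun j _ => sq_nonneg (pd v i j x))).1 hx i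
            (Finset.mem_univ i)
        have h3 := (Finset.sum_eq_zero_iff_of_nonneg
          (fun j _ => sq_nonneg (pd v i j x))).1 h2 j (Finset.mem_univ j)
        exact pow_eq_zero_iff (two_ne_zero) |>.1 h3
      simp [h1]
  set a := Real.sqrt (∫ x, ‖v x‖ ^ 2) with ha
  set b := Real.sqrt (∫ x, ∑ i, ∑ j, pd v i j x ^ 2) with hb
  have ha0 : 0 < a := Real.sqrt_pos.2 hA
  have hb0 : 0 < b := Real.sqrt_pos.2 hB
  have haa : ∫ x, ‖v x‖ ^ 2 = a ^ 2 := (Real.sq_sqrt hA0).symm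
  have hbb : ∫ x, ∑ i, ∑ j, pd v i j x ^ 2 = b ^ 2 := (Real.sq_sqrt hB0).symm
  have key := eps_bound hσ0 hσ1 (div_pos ha0 hb0) u v Cu hCu hu hv hv2 hp hdiv hF
  rw [haa, hbb] at key
  refine key.trans (le_of_eq ?_)
  have e1 : (a / b) ^ (σ - 1) * a ^ 2 = a ^ (1 + σ) * b ^ (1 - σ) := by
    rw [Real.div_rpow ha0.le hb0.le, show 1 - σ = -(σ - 1) by ring, Real.rpow_neg hb0.le,
      show 1 + σ = (σ - 1) + (2 : ℕ) by push_cast; ring, Real.rpow_add_natCast ha0.ne']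
    field_simp
  have e2 : (a / b) ^ (σ + 1) * b ^ 2 = a ^ (1 + σ) * b ^ (1 - σ) := by
    rw [Real.div_rpow ha0.le hb0.le, show 1 - σ = -(σ + 1) + (2 : ℕ) by push_cast; ring,
      Real.rpow_add_natCast hb0.ne', Real.rpow_neg hb0.le, add_comm 1 σ]
    field_simp
  rw [e1, e2]
  ring
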